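/- Let J₉ ∈ ℂ[x,y] be the degree-9 real polynomial J₉(x,y) = −1 + 2·Re(j₉(x+iy, x−iy)) (for real x, y) with j₉(u,v) = (9−27b)u³ − 9b·u⁶ − b·u⁹ + (27/2)uv − (9−54b)u⁴v + 9b·u⁷v − 27u²v² − 27b·u⁵v² + 15u³v³, b = exp(−iπ/3), and let f ∈ ℂ[x,y,z] be f = J₉(x,y) + z³(3 − 3z + z²)³. Then the singular locus {p ∈ ℂ³ : f(p) = 0 and ∇f(p) = 0} consists of exactly 127 points, and at each of these points the Hessian matrix of f has rank exactly 2; i.e. the nonic surface f = 0 has exactly 127 singular points, all cusps (A₂-singularities). -/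

import Mathlib

noncomputable section

/-- `bC = exp(-iπ/3)`. -/
def bC : ℂ := Complex.exp (-((Real.pi : ℂ) / 3) * Complex.I)

/-- The polynomial `j9(u,v)`. -/
def j9 (u v : ℂ) : ℂ := (9 - 27*bC)*u^3 - 9*bC*u^6 - bC*u^9 + (27/2)*u*v - (9 - 54*bC)*u^4*v + 9*bC*u^7*v - 27*u^2*v^2 - 27*bC*u^5*v^2 + 15*u^3*v^3

section gen
variable {R : Type*} [CommRing R]
def Pg (u v : R) : R := u^3 - 3*u*v + 3
def LP (b P Q : R) : R := 3*Q - 3*b*P^2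
def LQ (b P Q : R) : R := 3*P - 3*(1-b)*Q^2
def Fg (b u v : R) : R :=
  -1 - b*(Pg u v)^3 - (1-b)*(Pg v u)^3 + 3*Pg u v*Pg v u
def pullU (A B u v : R) : R := A*(3*u^2-3*v) + B*(-3*v)
def pullV (A B u v : R) : R := A*(-3*u) + B*(3*v^2-3*u)
def pullUU (A _B D E G u v : R) : R :=
  D*(3*u^2-3*v)^2 + 2*E*(3*u^2-3*v)*(-3*v) + G*(-3*v)^2 + A*(6*u)
def pullUV (A B D E G u v : R) : R :=
  D*(3*u^2-3*v)*(-3*u) + E*((3*u^2-3*v)*(3*v^2-3*u) + (-3*u)*(-3*v))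
    + G*(-3*v)*(3*v^2-3*u) - 3*A - 3*B
def pullVV (_A B D E G u v : R) : R :=
  D*(-3*u)^2 + 2*E*(-3*u)*(3*v^2-3*u) + G*(3*v^2-3*u)^2 + B*(6*v)
def Fu (b u v : R) : R := pullU (LP b (Pg u v) (Pg v u)) (LQ b (Pg u v) (Pg v u)) u v
def Fv (b u v : R) : R := pullV (LP b (Pg u v) (Pg v u)) (LQ b (Pg u v) (Pg v u)) u v
def Fuu (b u v : R) : R := pullUU (LP b (Pg u v) (Pg v u)) (LQ b (Pg u v) (Pg v u))
  (-6*b*Pg u v) 3 (-6*(1-b)*Pg v u) u v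
def Fuv (b u v : R) : R := pullUV (LP b (Pg u v) (Pg v u)) (LQ b (Pg u v) (Pg v u))
  (-6*b*Pg u v) 3 (-6*(1-b)*Pg v u) u v
def Fvv (b u v : R) : R := pullVV (LP b (Pg u v) (Pg v u)) (LQ b (Pg u v) (Pg v u))
  (-6*b*Pg u v) 3 (-6*(1-b)*Pg v u) u v

variable {S : Type*} [CommRing S] [Algebra S R] (D : Derivation S R R)
lemma D_Fg (b u v : R) (hb : D b = 0) : D (Fg b u v) = Fu b u v * D u + Fv b u v * D v := by
  have h3 : D 3 = 0 := by simpa using D.map_natCast 3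
  simp only [Fg, Fu, Fv, Pg, LP, LQ, pullU, pullV, map_add, map_sub, map_neg, D.leibniz, D.leibniz_pow, D.map_one_eq_zero, h3, hb, smul_eq_mul, nsmul_eq_mul]
  push_cast
  ring
lemma D_Fu (b u v : R) (hb : D b = 0) : D (Fu b u v) = Fuu b u v * D u + Fuv b u v * D v := by
  have h3 : D 3 = 0 := by simpa using D.map_natCast 3
  simp only [Fu, Fuu, Fuv, Pg, LP, LQ, pullU, pullUU, pullUV, map_add, map_sub, map_neg, D.leibniz, D.leibniz_pow, D.map_one_eq_zero, h3, hb, smul_eq_mul, nsmul_eq_mul]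
  push_cast
  ring
lemma D_Fv (b u v : R) (hb : D b = 0) : D (Fv b u v) = Fuv b u v * D u + Fvv b u v * D v := by
  have h3 : D 3 = 0 := by simpa using D.map_natCast 3
  simp only [Fv, Fvv, Fuv, Pg, LP, LQ, pullV, pullVV, pullUV, map_add, map_sub, map_neg, D.leibniz, D.leibniz_pow, D.map_one_eq_zero, h3, hb, smul_eq_mul, nsmul_eq_mul]
  push_cast
  ring
end gen

/-- elementary symmetric functions of cubes. -/
lemma Pg_cubes {t₁ t₂ t₃ : ℂ} (h : t₁*t₂*t₃ = 1) :
    Pg (t₁+t₂+t₃) (t₁*t₂+t₁*t₃+t₂*t₃) = t₁^3+t₂^3+t₃^3 := by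
  unfold Pg; linear_combination (-3)*h
lemma Pg_cubes' {t₁ t₂ t₃ : ℂ} (h : t₁*t₂*t₃ = 1) :
    Pg (t₁*t₂+t₁*t₃+t₂*t₃) (t₁+t₂+t₃) = t₁^3*t₂^3+t₁^3*t₃^3+t₂^3*t₃^3 := by
  have := Pg_cubes (t₁ := t₁*t₂) (t₂ := t₁*t₃) (t₃ := t₂*t₃) (by linear_combination (t₁*t₂*t₃+1)*h)
  rw [show t₁*t₂*(t₁*t₃)+t₁*t₂*(t₂*t₃)+t₁*t₃*(t₂*t₃) = t₁+t₂+t₃ by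
    linear_combination (t₁+t₂+t₃)*h] at this
  rw [this]; ring

lemma pull_dir {A B t₁ t₂ t₃ : ℂ} (h : t₁*t₂*t₃ = 1) :
    pullU A B (t₁+t₂+t₃) (t₁*t₂+t₁*t₃+t₂*t₃) + t₂ * pullV A B (t₁+t₂+t₃) (t₁*t₂+t₁*t₃+t₂*t₃)
     = 3*(t₁^2+t₁*t₃+t₃^2)*(A + t₂^3*B) := by
  obtain ⟨h1, h2⟩ : t₁ ≠ 0 ∧ t₂ ≠ 0 := by constructor <;> rintro rfl <;> simp at h
  obtain rfl : t₃ = (t₁*t₂)⁻¹ := by field_simp; linear_combination h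
  unfold pullU pullV; field_simp; ring

lemma L_dir {b t₁ t₂ t₃ : ℂ} (h : t₁*t₂*t₃ = 1) :
    LP b (t₁+t₂+t₃) (t₁*t₂+t₁*t₃+t₂*t₃) + t₂ * LQ b (t₁+t₂+t₃) (t₁*t₂+t₁*t₃+t₂*t₃)
     = -3*(t₁^2+t₁*t₃+t₃^2)*(b + t₂^3*(1-b)) := by
  obtain ⟨h1, h2⟩ : t₁ ≠ 0 ∧ t₂ ≠ 0 := by constructor <;> rintro rfl <;> simp at h
  obtain rfl : t₃ = (t₁*t₂)⁻¹ := by field_simp; linear_combination h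
  unfold LP LQ; field_simp; ring

lemma F_dir {b t₁ t₂ t₃ : ℂ} (h : t₁*t₂*t₃ = 1) :
    Fu b (t₁+t₂+t₃) (t₁*t₂+t₁*t₃+t₂*t₃) + t₂ * Fv b (t₁+t₂+t₃) (t₁*t₂+t₁*t₃+t₂*t₃)
     = -9*((t₁^2+t₁*t₃+t₃^2)*(t₁^6+t₁^3*t₃^3+t₃^6))*(b + t₂^9*(1-b)) := by
  have h3 : t₁^3*t₂^3*t₃^3 = 1 := by rw [← mul_pow, ← mul_pow, h, one_pow]
  rw [Fu, Fv, pull_dir h, Pg_cubes h, Pg_cubes' h, L_dir h3]; ring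

lemma F_val {b t₁ t₂ t₃ : ℂ} (h : t₁*t₂*t₃ = 1) :
    Fg b (t₁+t₂+t₃) (t₁*t₂+t₁*t₃+t₂*t₃) = 2 - b*(t₁^9+t₂^9+t₃^9)
      - (1-b)*(t₁^9*t₂^9+t₁^9*t₃^9+t₂^9*t₃^9) := by
  have h3 : t₁^3*t₂^3*t₃^3 = 1 := by rw [← mul_pow, ← mul_pow, h, one_pow]
  have e1 := Pg_cubes h3
  have e2 := Pg_cubes' h3
  rw [Fg, Pg_cubes h, Pg_cubes' h]
  simp only [Pg] at e1 e2
  linear_combination -b*e1-(1-b)*e2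

def TH11 (A B D E G t₁ t₂ t₃ : ℂ) : ℂ :=
  (t₁-t₃)^2*(D+2*t₂*E+t₂^2*G) + A*(t₁+t₃) + B*(t₂*t₃+t₁*t₂)
def TH12 (A B D E G t₁ t₂ t₃ : ℂ) : ℂ :=
  (t₁-t₃)*(t₂-t₃)*(D+(t₁+t₂)*E+t₁*t₂*G) + A*t₃ + B*(t₁*t₂)

lemma pull_TH11 {A B D E G t₁ t₂ t₃ u v : ℂ} (h : t₁*t₂*t₃ = 1) (hu : u = t₁+t₂+t₃)
   (hv : v = t₁*t₂+t₁*t₃+t₂*t₃) :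
   TH11 (pullU A B u v) (pullV A B u v) (pullUU A B D E G u v) (pullUV A B D E G u v)
    (pullVV A B D E G u v) t₁ t₂ t₃ = 9 * TH11 A B D E G (t₁^3) (t₂^3) (t₃^3) := by
  subst hu hv
  obtain ⟨h1, h2⟩ : t₁ ≠ 0 ∧ t₂ ≠ 0 := by constructor <;> rintro rfl <;> simp at h
  obtain rfl : t₃ = (t₁*t₂)⁻¹ := by field_simp; linear_combination h
  unfold TH11 pullU pullV pullUU pullUV pullVV; field_simp; ring

lemma pull_TH12 {A B D E G t₁ t₂ t₃ u v : ℂ} (h : t₁*t₂*t₃ = 1) (hu : u = t₁+t₂+t₃)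
   (hv : v = t₁*t₂+t₁*t₃+t₂*t₃) :
   TH12 (pullU A B u v) (pullV A B u v) (pullUU A B D E G u v) (pullUV A B D E G u v)
    (pullVV A B D E G u v) t₁ t₂ t₃ = 9 * TH12 A B D E G (t₁^3) (t₂^3) (t₃^3) := by
  subst hu hv
  obtain ⟨h1, h2⟩ : t₁ ≠ 0 ∧ t₂ ≠ 0 := by constructor <;> rintro rfl <;> simp at h
  obtain rfl : t₃ = (t₁*t₂)⁻¹ := by field_simp; linear_combination h
  unfold TH12 pullU pullV pullUU pullUV pullVV; field_simp; ring

lemma L_TH11 {b t₁ t₂ t₃ P Q : ℂ} (h : t₁*t₂*t₃ = 1) (hP : P = t₁+t₂+t₃)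
   (hQ : Q = t₁*t₂+t₁*t₃+t₂*t₃) :
   TH11 (LP b P Q) (LQ b P Q) (-6*b*P) 3 (-6*(1-b)*Q) t₁ t₂ t₃
     = -9*(b*(t₁^3+t₃^3)+(1-b)*(t₂^3*t₃^3+t₁^3*t₂^3)) := by
  subst hP hQ
  obtain ⟨h1, h2⟩ : t₁ ≠ 0 ∧ t₂ ≠ 0 := by constructor <;> rintro rfl <;> simp at h
  obtain rfl : t₃ = (t₁*t₂)⁻¹ := by field_simp; linear_combination h
  unfold TH11 LP LQ; field_simp; ring

lemma L_TH12 {b t₁ t₂ t₃ P Q : ℂ} (h : t₁*t₂*t₃ = 1) (hP : P = t₁+t₂+t₃)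
   (hQ : Q = t₁*t₂+t₁*t₃+t₂*t₃) :
   TH12 (LP b P Q) (LQ b P Q) (-6*b*P) 3 (-6*(1-b)*Q) t₁ t₂ t₃
     = -9*(b*t₃^3+(1-b)*(t₁^3*t₂^3)) := by
  subst hP hQ
  obtain ⟨h1, h2⟩ : t₁ ≠ 0 ∧ t₂ ≠ 0 := by constructor <;> rintro rfl <;> simp at h
  obtain rfl : t₃ = (t₁*t₂)⁻¹ := by field_simp; linear_combination h
  unfold TH12 LP LQ; field_simp; ring

lemma F_TH11 {b t₁ t₂ t₃ u v : ℂ} (h : t₁*t₂*t₃ = 1) (hu : u = t₁+t₂+t₃)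
   (hv : v = t₁*t₂+t₁*t₃+t₂*t₃) :
   TH11 (Fu b u v) (Fv b u v) (Fuu b u v) (Fuv b u v) (Fvv b u v) t₁ t₂ t₃
     = -81*(b*(t₁^9+t₃^9)+(1-b)*(t₂^9*t₃^9+t₁^9*t₂^9)) := by
  have h3 : t₁^3*t₂^3*t₃^3 = 1 := by rw [← mul_pow, ← mul_pow, h, one_pow]
  rw [Fu, Fv, Fuu, Fuv, Fvv, pull_TH11 h hu hv, hu, hv, Pg_cubes h, Pg_cubes' h,
    L_TH11 h3 rfl rfl]; ring
lemma F_TH12 {b t₁ t₂ t₃ u v : ℂ} (h : t₁*t₂*t₃ = 1) (hu : u = t₁+t₂+t₃)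
   (hv : v = t₁*t₂+t₁*t₃+t₂*t₃) :
   TH12 (Fu b u v) (Fv b u v) (Fuu b u v) (Fuv b u v) (Fvv b u v) t₁ t₂ t₃
     = -81*(b*t₃^9+(1-b)*(t₁^9*t₂^9)) := by
  have h3 : t₁^3*t₂^3*t₃^3 = 1 := by rw [← mul_pow, ← mul_pow, h, one_pow]
  rw [Fu, Fv, Fuu, Fuv, Fvv, pull_TH12 h hu hv, hu, hv, Pg_cubes h, Pg_cubes' h,
    L_TH12 h3 rfl rfl]; ring

/-- nondegeneracy at critical points -/
lemma hess_ne {b t₁ t₂ t₃ u v : ℂ} (h : t₁*t₂*t₃ = 1) (hu : u = t₁+t₂+t₃)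
   (hv : v = t₁*t₂+t₁*t₃+t₂*t₃) (h1 : Fu b u v = 0) (h2 : Fv b u v = 0)
   {c₁ c₂ c₃ : ℂ} (hc1 : c₁ = b*t₁^9+(1-b)*(t₂^9*t₃^9)) (hc2 : c₂ = b*t₂^9+(1-b)*(t₁^9*t₃^9))
   (hc3 : c₃ = b*t₃^9+(1-b)*(t₁^9*t₂^9)) (hc : c₁*c₂+c₁*c₃+c₂*c₃ ≠ 0) :
   Fuu b u v * Fvv b u v - Fuv b u v ^ 2 ≠ 0 := by
  intro h0
  have e11 := F_TH11 (b := b) h hu hv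
  have e12 := F_TH12 (b := b) h hu hv
  have e22 := F_TH11 (b := b) (t₁ := t₂) (t₂ := t₁) (t₃ := t₃) (u := u) (v := v)
    (by rw [← h]; ring) (by rw [hu]; ring) (by rw [hv]; ring)
  simp only [TH11, TH12, h1, h2, zero_mul, add_zero] at e11 e12 e22
  apply hc
  have f11 : (t₁-t₃)^2*(Fuu b u v+2*t₂*Fuv b u v+t₂^2*Fvv b u v) = -81*(c₁+c₃) := by
    rw [e11, hc1, hc3]; ring
  have f22 : (t₂-t₃)^2*(Fuu b u v+2*t₁*Fuv b u v+t₁^2*Fvv b u v) = -81*(c₂+c₃) := by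
    rw [e22, hc2, hc3]; ring
  have f12 : (t₁-t₃)*(t₂-t₃)*(Fuu b u v+(t₁+t₂)*Fuv b u v+t₁*t₂*Fvv b u v) = -81*c₃ := by
    rw [e12, hc3]
  have key : (-81*(c₁+c₃))*(-81*(c₂+c₃)) - (-81*c₃)^2 = 0 := by
    rw [← f11, ← f22, ← f12]
    linear_combination ((t₁-t₃)*(t₂-t₃)*(t₁-t₂))^2 * h0
  linear_combination key/6561

lemma cubic_roots (u v : ℂ) : ∃ t₁ t₂ t₃ : ℂ, t₁*t₂*t₃ = 1 ∧ u = t₁+t₂+t₃ ∧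
    v = t₁*t₂+t₁*t₃+t₂*t₃ := by
  obtain ⟨t, ht⟩ : ∃ t : ℂ, t^3 - u*t^2 + v*t - 1 = 0 := by
    have hd : (Polynomial.X^3 - Polynomial.C u * Polynomial.X^2 + Polynomial.C v * Polynomial.X
      - Polynomial.C 1 : Polynomial ℂ).degree = 3 := by compute_degree!
    obtain ⟨t, ht⟩ := IsAlgClosed.exists_root (Polynomial.X^3 - Polynomial.C u * Polynomial.X^2 +
      Polynomial.C v * Polynomial.X - Polynomial.C 1 : Polynomial ℂ) (by rw [hd]; norm_num)
    exact ⟨t, by simpa using ht⟩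
  have h0 : t ≠ 0 := by rintro rfl; simp at ht
  obtain ⟨d, hd⟩ := IsAlgClosed.exists_pow_nat_eq ((u-t)^2-4/t) (n := 2) (by norm_num)
  have hd' : t*d^2 = t*(u-t)^2-4 := by rw [hd]; field_simp
  refine ⟨t, (u-t+d)/2, (u-t-d)/2, ?_, by ring, ?_⟩
  · linear_combination -hd'/4
  · apply mul_left_cancel₀ h0
    linear_combination ht + hd'/4

lemma dir_zero {b t₁ t₂ t₃ u v : ℂ} (hb : b^2 = b-1) (h : t₁*t₂*t₃ = 1) (hu : u = t₁+t₂+t₃)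
    (hv : v = t₁*t₂+t₁*t₃+t₂*t₃) (h1 : Fu b u v = 0) (h2 : Fv b u v = 0) :
    t₂^9 = 1-b ∨ (t₁^9 = t₃^9 ∧ t₁ ≠ t₃) := by
  have e := F_dir (b := b) h
  rw [← hu, ← hv, h1, h2] at e
  have e' : ((t₁^2+t₁*t₃+t₃^2)*(t₁^6+t₁^3*t₃^3+t₃^6))*(b + t₂^9*(1-b)) = 0 := by
    linear_combination e/9
  rcases mul_eq_zero.1 e' with e1 | e1
  · right
    refine ⟨by linear_combination (t₁-t₃)*e1, ?_⟩
    rintro rfl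
    have : t₁^8 = 0 := by linear_combination e1/9
    have h0 : t₁ = 0 := by simpa using this
    simp [h0] at h
  · left; linear_combination b*e1 + (t₂^9-1)*hb

lemma crit_class {b t₁ t₂ t₃ u v : ℂ} (hb : b^2 = b-1) (h : t₁*t₂*t₃ = 1) (hu : u = t₁+t₂+t₃)
    (hv : v = t₁*t₂+t₁*t₃+t₂*t₃) (h1 : Fu b u v = 0) (h2 : Fv b u v = 0) :
    (t₁ ≠ t₂ ∧ t₁^9 = 1-b ∧ t₂^9 = 1-b) ∨ (t₁ ≠ t₃ ∧ t₁^9 = 1-b ∧ t₃^9 = 1-b) ∨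
    (t₂ ≠ t₃ ∧ t₂^9 = 1-b ∧ t₃^9 = 1-b) ∨
    (t₁ ≠ t₂ ∧ t₁ ≠ t₃ ∧ t₂ ≠ t₃ ∧ t₂^9 = t₁^9 ∧ t₃^9 = t₁^9) := by
  have d2 := dir_zero hb h hu hv h1 h2
  have d1 := dir_zero (t₁ := t₂) (t₂ := t₁) (t₃ := t₃) hb (by rw [← h]; ring) (by rw [hu]; ring)
    (by rw [hv]; ring) h1 h2
  have d3 := dir_zero (t₁ := t₁) (t₂ := t₃) (t₃ := t₂) hb (by rw [← h]; ring) (by rw [hu]; ring)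
    (by rw [hv]; ring) h1 h2
  have h9 : t₁^9*t₂^9*t₃^9 = 1 := by rw [← mul_pow, ← mul_pow, h, one_pow]
  have hno : ¬ (t₁^9 = 1-b ∧ t₂^9 = 1-b ∧ t₃^9 = 1-b) := by
    rintro ⟨a1, a2, a3⟩
    rw [a1, a2, a3] at h9
    have : (2:ℂ) = 0 := by linear_combination (2-b)*hb - h9
    norm_num at this
  rcases d1 with d1 | ⟨d1, d1'⟩ <;> rcases d2 with d2 | ⟨d2, d2'⟩ <;>
    rcases d3 with d3 | ⟨d3, d3'⟩
  · exact absurd ⟨d1, d2, d3⟩ hno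
  · exact Or.inl ⟨d3', d1, d2⟩
  · exact Or.inr (Or.inl ⟨d2', d1, d3⟩)
  · exact absurd ⟨d1, d3 ▸ d1, d2 ▸ d1⟩ hno
  · exact Or.inr (Or.inr (Or.inl ⟨d1', d2, d3⟩))
  · exact absurd ⟨d3.trans d2, d2, d1 ▸ d2⟩ hno
  · exact absurd ⟨d2.trans d3, d1.trans d3, d3⟩ hno
  · exact Or.inr (Or.inr (Or.inr ⟨d3', d2', d1', d3.symm, d2.symm⟩))

lemma solve_two {A B s t : ℂ} (hst : s ≠ t) (h1 : A + s*B = 0) (h2 : A + t*B = 0) :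
    A = 0 ∧ B = 0 := by
  have hB : B = 0 := by
    have : (s-t)*B = 0 := by linear_combination h1 - h2
    exact (mul_eq_zero.1 this).resolve_left (sub_ne_zero.2 hst)
  exact ⟨by simpa [hB] using h1, hB⟩

/-- type A points -/
lemma typeA {b t₁ t₂ t₃ u v : ℂ} (hb : b^2 = b-1) (h : t₁*t₂*t₃ = 1) (hu : u = t₁+t₂+t₃)
    (hv : v = t₁*t₂+t₁*t₃+t₂*t₃) (hne : t₁ ≠ t₂) (h1 : t₁^9 = 1-b) (h2 : t₂^9 = 1-b) :
    Fu b u v = 0 ∧ Fv b u v = 0 ∧ Fg b u v = 0 ∧ Fuu b u v * Fvv b u v - Fuv b u v ^ 2 ≠ 0 := by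
  have h9 : t₁^9*t₂^9*t₃^9 = 1 := by rw [← mul_pow, ← mul_pow, h, one_pow]
  have h3 : t₃^9 = b-1 := by
    rw [h1, h2] at h9
    linear_combination (b-1)*h9 + (2-b)*t₃^9*hb
  have e2 := F_dir (b := b) h
  have e1 := F_dir (b := b) (t₁ := t₂) (t₂ := t₁) (t₃ := t₃) (by rw [← h]; ring)
  rw [show t₂+t₁+t₃ = u by rw [hu]; ring, show t₂*t₁+t₂*t₃+t₁*t₃ = v by rw [hv]; ring, h1,
    show b + (1-b)*(1-b) = 0 by linear_combination hb, mul_zero] at e1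
  rw [← hu, ← hv, h2, show b + (1-b)*(1-b) = 0 by linear_combination hb, mul_zero] at e2
  obtain ⟨g1, g2⟩ := solve_two hne e1 e2
  refine ⟨g1, g2, ?_, ?_⟩
  · rw [hu, hv, F_val h, h1, h2, h3]; linear_combination (-b+3)*hb
  · have x1 : b*t₁^9+(1-b)*(t₂^9*t₃^9) = 2 := by
      rw [h1, h2, h3]; linear_combination (b-3)*hb
    have x2 : b*t₂^9+(1-b)*(t₁^9*t₃^9) = 2 := by
      rw [h1, h2, h3]; linear_combination (b-3)*hb
    have x3 : b*t₃^9+(1-b)*(t₁^9*t₂^9) = -2 := by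
      rw [h1, h2, h3]; linear_combination (3-b)*hb
    refine hess_ne h hu hv g1 g2 x1.symm x2.symm x3.symm ?_
    norm_num

/-- type B points, gradient -/
lemma typeB_grad {b t₁ t₂ t₃ u v : ℂ} (h : t₁*t₂*t₃ = 1) (hu : u = t₁+t₂+t₃)
    (hv : v = t₁*t₂+t₁*t₃+t₂*t₃) (h12 : t₁ ≠ t₂) (h13 : t₁ ≠ t₃) (h23 : t₂ ≠ t₃)
    (h1 : t₂^9 = t₁^9) (h2 : t₃^9 = t₁^9) :
    Fu b u v = 0 ∧ Fv b u v = 0 := by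
  have e2 := F_dir (b := b) h
  have e1 := F_dir (b := b) (t₁ := t₂) (t₂ := t₁) (t₃ := t₃) (by rw [← h]; ring)
  have k : ∀ s t : ℂ, s ≠ t → s^9 = t^9 → (s^2+s*t+t^2)*(s^6+s^3*t^3+t^6) = 0 := by
    intro s t hst h
    have : (s-t)*((s^2+s*t+t^2)*(s^6+s^3*t^3+t^6)) = 0 := by linear_combination h
    exact (mul_eq_zero.1 this).resolve_left (sub_ne_zero.2 hst)
  rw [show t₂+t₁+t₃ = u by rw [hu]; ring, show t₂*t₁+t₂*t₃+t₁*t₃ = v by rw [hv]; ring,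
    k _ _ h23 (h1.trans h2.symm), mul_zero, zero_mul] at e1
  rw [← hu, ← hv, k _ _ h13 h2.symm, mul_zero, zero_mul] at e2
  exact solve_two h12 e1 e2

lemma typeB {b t₁ t₂ t₃ u v : ℂ} (hb : b^2 = b-1) (h : t₁*t₂*t₃ = 1) (hu : u = t₁+t₂+t₃)
    (hv : v = t₁*t₂+t₁*t₃+t₂*t₃) (h12 : t₁ ≠ t₂) (h13 : t₁ ≠ t₃) (h23 : t₂ ≠ t₃)
    (h1 : t₂^9 = t₁^9) (h2 : t₃^9 = t₁^9) (hT : t₁^9 = 1 ∨ t₁^9 = -b) :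
    Fu b u v = 0 ∧ Fv b u v = 0 ∧ Fg b u v = -1 ∧ Fuu b u v * Fvv b u v - Fuv b u v ^ 2 ≠ 0 := by
  obtain ⟨g1, g2⟩ := typeB_grad (b := b) h hu hv h12 h13 h23 h1 h2
  have key : b*t₁^9+(1-b)*(t₁^9*t₁^9) = 1 := by
    rcases hT with hT | hT <;> rw [hT]
    · ring
    · linear_combination (-b-1)*hb
  refine ⟨g1, g2, ?_, ?_⟩
  · rw [hu, hv, F_val h, h1, h2]; linear_combination (-3)*key
  · refine hess_ne h hu hv g1 g2 (c₁ := 1) (c₂ := 1) (c₃ := 1) ?_ ?_ ?_ (by norm_num) <;>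
    rw [h1, h2] <;> exact key.symm
 
lemma crit0 {b u v : ℂ} (hb : b^2 = b-1) (h1 : Fu b u v = 0) (h2 : Fv b u v = 0)
    (h0 : Fg b u v = 0) : ∃ t₁ t₂ t₃ : ℂ, t₁*t₂*t₃ = 1 ∧ u = t₁+t₂+t₃ ∧
    v = t₁*t₂+t₁*t₃+t₂*t₃ ∧ t₁ ≠ t₂ ∧ t₁^9 = 1-b ∧ t₂^9 = 1-b := by
  obtain ⟨t₁, t₂, t₃, h, hu, hv⟩ := cubic_roots u v
  rcases crit_class hb h hu hv h1 h2 with h' | h' | h' | ⟨h12, h13, h23, e2, e3⟩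
  · exact ⟨t₁, t₂, t₃, h, hu, hv, h'⟩
  · exact ⟨t₁, t₃, t₂, by rw [← h]; ring, by rw [hu]; ring, by rw [hv]; ring, h'⟩
  · exact ⟨t₂, t₃, t₁, by rw [← h]; ring, by rw [hu]; ring, by rw [hv]; ring, h'⟩
  · exfalso
    have h9 : t₁^9*t₂^9*t₃^9 = 1 := by rw [← mul_pow, ← mul_pow, h, one_pow]
    rw [hu, hv, F_val h, e2, e3] at h0
    rw [e2, e3] at h9
    generalize t₁^9 = T at h0 h9
    have : (T-1)*((T+b)*(T-b+1)) = 0 := by linear_combination h9 - (T-1)*hb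
    rcases mul_eq_zero.1 this with h | h
    · have : T = 1 := by linear_combination h
      rw [this] at h0
      have : (-1:ℂ) = 0 := by linear_combination h0
      norm_num at this
    rcases mul_eq_zero.1 h with h | h
    · have : T = -b := by linear_combination h
      rw [this] at h0
      have : (-1:ℂ) = 0 := by linear_combination h0 - 3*(b+1)*hb
      norm_num at this
    · have : T = b-1 := by linear_combination h
      rw [this] at h0
      have : (8:ℂ) = 0 := by linear_combination h0 + (-3*b+9)*hb
      norm_num at this

lemma crit1 {b u v : ℂ} (hb : b^2 = b-1) (h1 : Fu b u v = 0) (h2 : Fv b u v = 0)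
    (h0 : Fg b u v = -1) : ∃ t₁ t₂ t₃ : ℂ, t₁*t₂*t₃ = 1 ∧ u = t₁+t₂+t₃ ∧
    v = t₁*t₂+t₁*t₃+t₂*t₃ ∧ t₁ ≠ t₂ ∧ t₁ ≠ t₃ ∧ t₂ ≠ t₃ ∧ t₂^9 = t₁^9 ∧ t₃^9 = t₁^9 ∧
    (t₁^9 = 1 ∨ t₁^9 = -b) := by
  obtain ⟨t₁, t₂, t₃, h, hu, hv⟩ := cubic_roots u v
  have hn : ¬ Fg b u v = 0 := by rw [h0]; norm_num
  rcases crit_class hb h hu hv h1 h2 with ⟨a, b, c⟩ | ⟨a, b, c⟩ | ⟨a, b, c⟩ | ⟨h12, h13, h23, e2, e3⟩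
  · exact absurd (typeA hb h hu hv a b c).2.2.1 hn
  · exact absurd (typeA (t₁ := t₁) (t₂ := t₃) (t₃ := t₂) hb (by rw [← h]; ring) (by rw [hu]; ring)
      (by rw [hv]; ring) a b c).2.2.1 hn
  · exact absurd (typeA (t₁ := t₂) (t₂ := t₃) (t₃ := t₁) hb (by rw [← h]; ring) (by rw [hu]; ring)
      (by rw [hv]; ring) a b c).2.2.1 hn
  · refine ⟨t₁, t₂, t₃, h, hu, hv, h12, h13, h23, e2, e3, ?_⟩
    rw [hu, hv, F_val h, e2, e3] at h0
    generalize t₁^9 = T at h0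
    have : (T-1)*(T+b) = 0 := by linear_combination b*(-h0/3) + (T^2-T)*hb
    rcases mul_eq_zero.1 this with h | h
    · left; linear_combination h
    · right; linear_combination h

lemma zpow_eq_iff {ζ : ℂ} (hζ : IsPrimitiveRoot ζ 54) (m n : ℕ) :
    ζ^m = ζ^n ↔ m % 54 = n % 54 := by
  have hm : ∀ m : ℕ, ζ^(m%54) = ζ^m := fun m => by
    conv_rhs => rw [← Nat.div_add_mod m 54, pow_add, pow_mul, hζ.pow_eq_one, one_pow, one_mul]
  constructor
  · intro h
    rw [← hm m, ← hm n] at h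
    exact hζ.pow_inj (Nat.mod_lt _ (by norm_num)) (Nat.mod_lt _ (by norm_num)) h
  · intro h; rw [← hm m, ← hm n, h]

lemma root_exp {ζ : ℂ} (hζ : IsPrimitiveRoot ζ 54) {t : ℂ} {r : ℕ} (hr : r < 6)
    (h : t^9 = ζ^(9*r)) : ∃ i < 54, i % 6 = r ∧ t = ζ^i := by
  have h54 : t^54 = 1 := by
    rw [show 54 = 9*6 by norm_num, pow_mul, h, ← pow_mul, show 9*r*6 = 54*r by ring, pow_mul,
      hζ.pow_eq_one, one_pow]
  obtain ⟨i, hi, rfl⟩ := hζ.eq_pow_of_pow_eq_one h54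
  refine ⟨i, hi, ?_, rfl⟩
  rw [← pow_mul, zpow_eq_iff hζ] at h
  omega

lemma triple_mem {s t₁ t₂ t₃ s₂ s₃ : ℂ} (h : t₁*t₂*t₃ = 1) (hs : s*s₂*s₃ = 1)
    (hu : s+s₂+s₃ = t₁+t₂+t₃) (hv : s*s₂+s*s₃+s₂*s₃ = t₁*t₂+t₁*t₃+t₂*t₃) :
    s = t₁ ∨ s = t₂ ∨ s = t₃ := by
  have : (s-t₁)*((s-t₂)*(s-t₃)) = 0 := by
    linear_combination s^2*hu - s*hv - h + hs
  rcases mul_eq_zero.1 this with h | h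
  · exact Or.inl (sub_eq_zero.1 h)
  · rcases mul_eq_zero.1 h with h | h
    · exact Or.inr (Or.inl (sub_eq_zero.1 h))
    · exact Or.inr (Or.inr (sub_eq_zero.1 h))

def thd (a : ℕ × ℕ) : ℕ := (108 - a.1 - a.2) % 54
def Ept (ζ : ℂ) (a : ℕ × ℕ) : ℂ × ℂ :=
  (ζ^a.1+ζ^a.2+ζ^(thd a), ζ^a.1*ζ^a.2+ζ^a.1*ζ^(thd a)+ζ^a.2*ζ^(thd a))
def S0 : Finset (ℕ × ℕ) := (Finset.range 54 ×ˢ Finset.range 54).filter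
  (fun a => a.1 < a.2 ∧ a.1 % 6 = 1 ∧ a.2 % 6 = 1)
def S1 : Finset (ℕ × ℕ) := (Finset.range 54 ×ˢ Finset.range 54).filter
  (fun a => a.1 < a.2 ∧ a.2 < thd a ∧ a.1 % 6 = a.2 % 6 ∧ (a.1 % 6 = 0 ∨ a.1 % 6 = 2))
lemma S0_card : S0.card = 36 := by decide +kernel
lemma S1_card : S1.card = 19 := by decide +kernel
lemma mem_S0 {a : ℕ × ℕ} : a ∈ S0 ↔ (a.1 < 54 ∧ a.2 < 54) ∧ a.1 < a.2 ∧ a.1 % 6 = 1 ∧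
    a.2 % 6 = 1 := by simp [S0]
lemma mem_S1 {a : ℕ × ℕ} : a ∈ S1 ↔ (a.1 < 54 ∧ a.2 < 54) ∧ a.1 < a.2 ∧ a.2 < thd a ∧
    a.1 % 6 = a.2 % 6 ∧ (a.1 % 6 = 0 ∨ a.1 % 6 = 2) := by simp [S1]

attribute [irreducible] S0 S1

lemma thd_mul {ζ : ℂ} (hζ : IsPrimitiveRoot ζ 54) {a : ℕ × ℕ} (h1 : a.1 < 54) (h2 : a.2 < 54) :
    ζ^a.1*ζ^a.2*ζ^(thd a) = 1 := by
  rw [← pow_add, ← pow_add, ← pow_zero ζ, zpow_eq_iff hζ]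
  unfold thd; omega

lemma zpow_inj {ζ : ℂ} (hζ : IsPrimitiveRoot ζ 54) {m n : ℕ} (hm : m < 54) (hn : n < 54)
    (h : ζ^m = ζ^n) : m = n := hζ.pow_inj hm hn h

lemma Ept_mem {ζ : ℂ} (hζ : IsPrimitiveRoot ζ 54) {a c : ℕ × ℕ} (h1 : a.1 < 54) (h2 : a.2 < 54)
    (h3 : c.1 < 54) (h4 : c.2 < 54) (h : Ept ζ a = Ept ζ c) :
    (a.1 = c.1 ∨ a.1 = c.2 ∨ a.1 = thd c) ∧ (a.2 = c.1 ∨ a.2 = c.2 ∨ a.2 = thd c) ∧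
    (thd a = c.1 ∨ thd a = c.2 ∨ thd a = thd c) := by
  have hl : ∀ a, thd a < 54 := fun a => Nat.mod_lt _ (by norm_num)
  simp only [Ept, Prod.mk.injEq] at h
  obtain ⟨hu, hv⟩ := h
  have ha := thd_mul hζ h1 h2
  have hc := thd_mul hζ h3 h4
  refine ⟨?_, ?_, ?_⟩
  · exact (triple_mem hc ha hu hv).imp (zpow_inj hζ h1 h3) (Or.imp (zpow_inj hζ h1 h4) (zpow_inj hζ h1 (hl _)))
  · exact (triple_mem (s₂ := ζ^a.1) (s₃ := ζ^thd a) hc (by rw [← ha]; ring) (by rw [← hu]; ring)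
      (by rw [← hv]; ring)).imp (zpow_inj hζ h2 h3)
      (Or.imp (zpow_inj hζ h2 h4) (zpow_inj hζ h2 (hl _)))
  · exact (triple_mem (s₂ := ζ^a.1) (s₃ := ζ^a.2) hc (by rw [← ha]; ring) (by rw [← hu]; ring)
      (by rw [← hv]; ring)).imp (zpow_inj hζ (hl _) h3)
      (Or.imp (zpow_inj hζ (hl _) h4) (zpow_inj hζ (hl _) (hl _)))

lemma Ept_inj0 {ζ : ℂ} (hζ : IsPrimitiveRoot ζ 54) : Set.InjOn (Ept ζ) S0 := by
  intro a ha c hc h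
  obtain ⟨⟨h1, h2⟩, h3⟩ := mem_S0.1 ha
  obtain ⟨⟨h4, h5⟩, h6⟩ := mem_S0.1 hc
  have := Ept_mem hζ h1 h2 h4 h5 h
  unfold thd at this
  ext <;> omega

lemma Ept_inj1 {ζ : ℂ} (hζ : IsPrimitiveRoot ζ 54) : Set.InjOn (Ept ζ) S1 := by
  intro a ha c hc h
  obtain ⟨⟨h1, h2⟩, h3⟩ := mem_S1.1 ha
  obtain ⟨⟨h4, h5⟩, h6⟩ := mem_S1.1 hc
  have := Ept_mem hζ h1 h2 h4 h5 h
  ext <;> omega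

def K (b w : ℂ) : Set (ℂ × ℂ) := {q | Fu b q.1 q.2 = 0 ∧ Fv b q.1 q.2 = 0 ∧ Fg b q.1 q.2 = w}

lemma K0_eq {ζ b : ℂ} (hζ : IsPrimitiveRoot ζ 54) (hb : b^2 = b-1) (h9 : ζ^9 = 1-b) :
    K b 0 = Ept ζ '' S0 := by
  ext ⟨u, v⟩
  constructor
  · rintro ⟨h1, h2, h0⟩
    simp only at h1 h2 h0
    obtain ⟨t₁, t₂, t₃, h, hu, hv, hne, e1, e2⟩ := crit0 hb h1 h2 h0
    obtain ⟨i, hi, hi6, rfl⟩ := root_exp hζ (r := 1) (by norm_num) (e1.trans h9.symm)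
    obtain ⟨j, hj, hj6, rfl⟩ := root_exp hζ (r := 1) (by norm_num) (e2.trans h9.symm)
    have hij : i ≠ j := fun h => hne (by rw [h])
    have h0 : ζ ≠ 0 := hζ.ne_zero (by norm_num)
    have hh : ∀ a c : ℂ, ζ^i*ζ^j*a = 1 → ζ^i*ζ^j*c = 1 → a = c := fun a c h h' =>
      mul_left_cancel₀ (mul_ne_zero (pow_ne_zero i h0) (pow_ne_zero j h0)) (h.trans h'.symm)
    rcases lt_or_gt_of_ne hij with hl | hl
    · refine ⟨(i, j), mem_S0.2 ⟨⟨hi, hj⟩, hl, hi6, hj6⟩, ?_⟩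
      have := hh _ _ h (thd_mul hζ (a := (i, j)) hi hj)
      simp only [Ept, ← this, hu, hv]
    · refine ⟨(j, i), mem_S0.2 ⟨⟨hj, hi⟩, hl, hj6, hi6⟩, ?_⟩
      have := hh _ (ζ^thd (j, i)) h (by rw [← thd_mul hζ (a := (j, i)) hj hi]; ring)
      simp only [Ept, ← this, hu, hv]
      ext <;> simp only <;> ring
  · rintro ⟨a, ha, he⟩
    obtain ⟨⟨h1, h2⟩, h3, h4, h5⟩ := mem_S0.1 ha
    simp only [Ept, Prod.mk.injEq] at he
    have e : ∀ i, i % 6 = 1 → (ζ^i)^9 = 1 - b := fun i hi => by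
      rw [← h9, ← pow_mul, zpow_eq_iff hζ]; omega
    obtain ⟨g1, g2, g3, -⟩ := typeA hb (thd_mul hζ h1 h2) he.1.symm he.2.symm
      (fun h => h3.ne (zpow_inj hζ h1 h2 h)) (e _ h4) (e _ h5)
    exact ⟨g1, g2, g3⟩

lemma sorted1 {ζ : ℂ} (hζ : IsPrimitiveRoot ζ 54) {i j k r : ℕ} (hi : i < 54) (hj : j < 54)
    (hk : k < 54) (h : ζ^i*ζ^j*ζ^k = 1) (hij : i < j) (hjk : j < k) (hi6 : i % 6 = r)
    (hj6 : j % 6 = r) (hr : r = 0 ∨ r = 2) :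
    ∃ a ∈ S1, Ept ζ a = (ζ^i+ζ^j+ζ^k, ζ^i*ζ^j+ζ^i*ζ^k+ζ^j*ζ^k) := by
  rw [← pow_add, ← pow_add, ← pow_zero ζ, zpow_eq_iff hζ] at h
  have : thd (i, j) = k := by unfold thd; simp only; omega
  refine ⟨(i, j), mem_S1.2 ⟨⟨hi, hj⟩, hij, by rw [this]; exact hjk, by simp only; omega,
    by simp only; omega⟩, by simp only [Ept, this]⟩

lemma K1_eq {ζ b : ℂ} (hζ : IsPrimitiveRoot ζ 54) (hb : b^2 = b-1) (h9 : ζ^9 = 1-b) :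
    K b (-1) = Ept ζ '' S1 := by
  have h18 : ζ^(9*2) = -b := by rw [pow_mul, h9]; linear_combination hb
  ext ⟨u, v⟩
  constructor
  · rintro ⟨h1, h2, h0⟩
    simp only at h1 h2 h0
    obtain ⟨t₁, t₂, t₃, h, hu, hv, h12, h13, h23, e2, e3, e⟩ := crit1 hb h1 h2 h0
    obtain ⟨r, hr, hr'⟩ : ∃ r, (r = 0 ∨ r = 2) ∧ t₁^9 = ζ^(9*r) := by
      rcases e with e | e
      · exact ⟨0, Or.inl rfl, by simpa using e⟩
      · exact ⟨2, Or.inr rfl, e.trans h18.symm⟩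
    have hr6 : r < 6 := by omega
    obtain ⟨i, hi, hi6, rfl⟩ := root_exp hζ hr6 hr'
    obtain ⟨j, hj, hj6, rfl⟩ := root_exp hζ hr6 (e2.trans hr')
    obtain ⟨k, hk, hk6, rfl⟩ := root_exp hζ hr6 (e3.trans hr')
    have hij : i ≠ j := fun h => h12 (by rw [h])
    have hik : i ≠ k := fun h => h13 (by rw [h])
    have hjk : j ≠ k := fun h => h23 (by rw [h])
    have fin : ∀ a c d : ℕ, a < 54 → c < 54 → d < 54 → a % 6 = r → c % 6 = r →
        ζ^a*ζ^c*ζ^d = ζ^i*ζ^j*ζ^k → ζ^a+ζ^c+ζ^d = u → ζ^a*ζ^c+ζ^a*ζ^d+ζ^c*ζ^d = v →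
        a < c → c < d → (u, v) ∈ Ept ζ '' S1 := by
      intro a c d ha hc hd ha6 hc6 hp hu' hv' hac hcd
      obtain ⟨x, hx, hx'⟩ := sorted1 hζ ha hc hd (hp.trans h) hac hcd ha6 hc6 hr
      exact ⟨x, hx, by rw [hx', hu', hv']⟩
    rcases lt_or_gt_of_ne hij with l1 | l1 <;> rcases lt_or_gt_of_ne hik with l2 | l2 <;>
      rcases lt_or_gt_of_ne hjk with l3 | l3
    · exact fin i j k hi hj hk hi6 hj6 (by ring) (by rw [hu]) (by rw [hv]) l1 l3
    · exact fin i k j hi hk hj hi6 hk6 (by ring) (by rw [hu]; ring) (by rw [hv]; ring) l2 l3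
    · omega
    · exact fin k i j hk hi hj hk6 hi6 (by ring) (by rw [hu]; ring) (by rw [hv]; ring) l2 l1
    · exact fin j i k hj hi hk hj6 hi6 (by ring) (by rw [hu]; ring) (by rw [hv]; ring) l1 l2
    · omega
    · exact fin j k i hj hk hi hj6 hk6 (by ring) (by rw [hu]; ring) (by rw [hv]; ring) l3 l2
    · exact fin k j i hk hj hi hk6 hj6 (by ring) (by rw [hu]; ring) (by rw [hv]; ring) l3 l1
  · rintro ⟨a, ha, he⟩
    obtain ⟨⟨h1, h2⟩, h3, h4, h5, h6⟩ := mem_S1.1 ha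
    have hl : thd a < 54 := Nat.mod_lt _ (by norm_num)
    have h7 : thd a % 6 = a.1 % 6 := by unfold thd; omega
    simp only [Ept, Prod.mk.injEq] at he
    have e : ∀ i, i % 6 = a.1 % 6 → (ζ^i)^9 = (ζ^a.1)^9 := fun i hi => by
      rw [← pow_mul, ← pow_mul, zpow_eq_iff hζ]; omega
    have hT : (ζ^a.1)^9 = 1 ∨ (ζ^a.1)^9 = -b := by
      rcases h6 with h | h
      · left; rw [← pow_mul, ← pow_zero ζ, zpow_eq_iff hζ]; omega
      · right; rw [← h18, ← pow_mul, zpow_eq_iff hζ]; omega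
    obtain ⟨g1, g2, g3, -⟩ := typeB hb (thd_mul hζ h1 h2) he.1.symm he.2.symm
      (fun h => h3.ne (zpow_inj hζ h1 h2 h)) (fun h => (h3.trans h4).ne (zpow_inj hζ h1 hl h))
      (fun h => h4.ne (zpow_inj hζ h2 hl h)) (e _ h5.symm) (e _ h7) hT
    exact ⟨g1, g2, g3⟩

lemma K0_ncard {ζ b : ℂ} (hζ : IsPrimitiveRoot ζ 54) (hb : b^2 = b-1) (h9 : ζ^9 = 1-b) :
    (K b 0).Finite ∧ (K b 0).ncard = 36 := by
  rw [K0_eq hζ hb h9]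
  exact ⟨(Finset.finite_toSet _).image _, by
    rw [(Ept_inj0 hζ).ncard_image, Set.ncard_coe_finset, S0_card]⟩
lemma K1_ncard {ζ b : ℂ} (hζ : IsPrimitiveRoot ζ 54) (hb : b^2 = b-1) (h9 : ζ^9 = 1-b) :
    (K b (-1)).Finite ∧ (K b (-1)).ncard = 19 := by
  rw [K1_eq hζ hb h9]
  exact ⟨(Finset.finite_toSet _).image _, by
    rw [(Ept_inj1 hζ).ncard_image, Set.ncard_coe_finset, S1_card]⟩

lemma K_hess {b u v w : ℂ} (hb : b^2 = b-1) (hw : w = 0 ∨ w = -1) (h : (u, v) ∈ K b w) :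
    Fuu b u v * Fvv b u v - Fuv b u v ^ 2 ≠ 0 := by
  obtain ⟨h1, h2, h0⟩ := h
  rcases hw with rfl | rfl
  · obtain ⟨t₁, t₂, t₃, h, hu, hv, hne, e1, e2⟩ := crit0 hb h1 h2 h0
    exact (typeA hb h hu hv hne e1 e2).2.2.2
  · obtain ⟨t₁, t₂, t₃, h, hu, hv, h12, h13, h23, e2, e3, e⟩ := crit1 hb h1 h2 h0
    exact (typeB hb h hu hv h12 h13 h23 e2 e3 e).2.2.2

lemma bfacts : ∃ ζ : ℂ, IsPrimitiveRoot ζ 54 ∧ bC^2 = bC - 1 ∧ ζ^9 = 1 - bC ∧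
    (starRingEnd ℂ) bC = 1 - bC := by
  have hz := Complex.isPrimitiveRoot_exp 54 (by norm_num)
  have hs : ((Real.sqrt 3 : ℝ) : ℂ)^2 = 3 := by
    rw [← Complex.ofReal_pow, Real.sq_sqrt (by norm_num)]; norm_num
  have hI := Complex.I_sq
  have c1 : Complex.cos ((Real.pi:ℂ)/3) = 1/2 := by
    have := congrArg (fun x : ℝ => (x:ℂ)) Real.cos_pi_div_three
    push_cast at this; exact this
  have s1 : Complex.sin ((Real.pi:ℂ)/3) = (Real.sqrt 3 : ℝ)/2 := by
    have := congrArg (fun x : ℝ => (x:ℂ)) Real.sin_pi_div_three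
    push_cast at this; exact this
  have hbv : bC = 1/2 - (Real.sqrt 3 : ℝ)/2 * Complex.I := by
    rw [bC, Complex.exp_mul_I, Complex.cos_neg, Complex.sin_neg, c1, s1]; ring
  refine ⟨_, hz, ?_, ?_, ?_⟩
  · rw [hbv]; linear_combination (Complex.I^2/4)*hs + 3/4*hI
  · rw [← Complex.exp_nat_mul, show ((9:ℕ):ℂ) * (2 * Real.pi * Complex.I / (54:ℕ)) =
      ((Real.pi:ℂ)/3)*Complex.I by push_cast; ring, Complex.exp_mul_I, c1, s1, hbv]; ring
  · rw [hbv]; simp [map_ofNat]; ring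

section maps
variable {R S : Type*} [CommRing R] [CommRing S] (φ : R →+* S)
lemma map_Fg (b u v : R) : φ (Fg b u v) = Fg (φ b) (φ u) (φ v) := by
  simp [Fg, Pg, map_ofNat]
lemma map_Fu (b u v : R) : φ (Fu b u v) = Fu (φ b) (φ u) (φ v) := by
  simp [Fu, Pg, pullU, LP, LQ, map_ofNat]
lemma map_Fv (b u v : R) : φ (Fv b u v) = Fv (φ b) (φ u) (φ v) := by
  simp [Fv, Pg, pullV, LP, LQ, map_ofNat]
lemma map_Fuu (b u v : R) : φ (Fuu b u v) = Fuu (φ b) (φ u) (φ v) := by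
  simp [Fuu, Pg, pullUU, LP, LQ, map_ofNat]
lemma map_Fuv (b u v : R) : φ (Fuv b u v) = Fuv (φ b) (φ u) (φ v) := by
  simp [Fuv, Pg, pullUV, LP, LQ, map_ofNat]
lemma map_Fvv (b u v : R) : φ (Fvv b u v) = Fvv (φ b) (φ u) (φ v) := by
  simp [Fvv, Pg, pullVV, LP, LQ, map_ofNat]
end maps

lemma j9_conj (hc : (starRingEnd ℂ) bC = 1 - bC) (x y : ℝ) :
    -1 + 2 * ((j9 ((x : ℂ) + (y : ℂ) * Complex.I) ((x : ℂ) - (y : ℂ) * Complex.I)).re : ℂ) =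
      Fg bC ((x : ℂ) + Complex.I * y) (x - Complex.I * y) := by
  have h := Complex.add_conj (j9 ((x : ℂ) + (y : ℂ) * Complex.I) ((x : ℂ) - (y : ℂ) * Complex.I))
  push_cast at h
  rw [← h]
  have hu : (starRingEnd ℂ) ((x : ℂ) + (y : ℂ) * Complex.I) = (x : ℂ) - (y : ℂ) * Complex.I := by
    simp; ring
  have hv : (starRingEnd ℂ) ((x : ℂ) - (y : ℂ) * Complex.I) = (x : ℂ) + (y : ℂ) * Complex.I := by
    simp
  rw [mul_comm Complex.I]
  generalize (x : ℂ) + (y : ℂ) * Complex.I = u at *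
  generalize (x : ℂ) - (y : ℂ) * Complex.I = v at *
  simp only [j9, map_add, map_sub, map_mul, map_pow, hu, hv, hc, map_ofNat, map_div₀, Fg, Pg]
  ring

lemma rank_two {M : Matrix (Fin 3) (Fin 3) ℂ} (h02 : M 0 2 = 0) (h12 : M 1 2 = 0)
    (h20 : M 2 0 = 0) (h21 : M 2 1 = 0) (h22 : M 2 2 = 0)
    (hd : M 0 0 * M 1 1 - M 0 1 * M 1 0 ≠ 0) : M.rank = 2 := by
  have h := LinearMap.finrank_range_add_finrank_ker M.mulVecLin
  have hk : Module.finrank ℂ (LinearMap.ker M.mulVecLin) = 1 := by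
    have hm : (![0, 0, 1] : Fin 3 → ℂ) ∈ LinearMap.ker M.mulVecLin := by
      rw [LinearMap.mem_ker]
      ext i
      fin_cases i <;> simp [Matrix.mulVec, dotProduct, Fin.sum_univ_three, h02, h12, h22]
    refine finrank_eq_one ⟨_, hm⟩ ?_ ?_
    · intro h
      have := congrFun (congrArg Subtype.val h) 2
      simp at this
    · rintro ⟨w, hw⟩
      rw [LinearMap.mem_ker] at hw
      have e0 := congrFun hw 0
      have e1 := congrFun hw 1
      simp [Matrix.mulVec, dotProduct, Fin.sum_univ_three, h02, h12] at e0 e1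
      have w0 : w 0 = 0 := by
        have : (M 0 0 * M 1 1 - M 0 1 * M 1 0) * w 0 = 0 := by
          linear_combination M 1 1 * e0 - M 0 1 * e1
        exact (mul_eq_zero.1 this).resolve_left hd
      have w1 : w 1 = 0 := by
        have : (M 0 0 * M 1 1 - M 0 1 * M 1 0) * w 1 = 0 := by
          linear_combination M 0 0 * e1 - M 1 0 * e0
        exact (mul_eq_zero.1 this).resolve_left hd
      refine ⟨w 2, ?_⟩
      ext i
      fin_cases i <;> simp [w0, w1]
  rw [hk, Module.finrank_fin_fun] at h
  change Module.finrank ℂ (LinearMap.range M.mulVecLin) = 2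
  omega

lemma cube_roots_ncard {ζ : ℂ} (hζ : IsPrimitiveRoot ζ 54) :
    {z : ℂ | (1-z)^3 = 1}.Finite ∧ {z : ℂ | (1-z)^3 = 1}.ncard = 3 := by
  have h3 : IsPrimitiveRoot (ζ^18) 3 := hζ.pow (by norm_num) (by norm_num)
  have : {z : ℂ | (1-z)^3 = 1} = (fun i : ℕ => 1 - (ζ^18)^i) '' (Finset.range 3) := by
    ext z
    constructor
    · intro h
      obtain ⟨i, hi, e⟩ := h3.eq_pow_of_pow_eq_one (ξ := 1-z) h
      exact ⟨i, by simpa using hi, by simp only [e]; ring⟩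
    · rintro ⟨i, -, rfl⟩
      change (1 - (1 - (ζ^18)^i))^3 = 1
      rw [sub_sub_cancel, ← pow_mul, mul_comm, pow_mul, h3.pow_eq_one, one_pow]
  rw [this]
  refine ⟨(Finset.finite_toSet _).image _, ?_⟩
  rw [Set.InjOn.ncard_image, Set.ncard_coe_finset, Finset.card_range]
  intro i hi j hj h
  simp only [Finset.coe_range, Set.mem_Iio] at hi hj
  exact h3.pow_inj hi hj (by simpa using h)

def toP (q : (ℂ × ℂ) × ℂ) : Fin 3 → ℂ :=
  ![(q.1.1+q.1.2)/2, (q.1.1-q.1.2)/(2*Complex.I), q.2]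

lemma toP_inj : Function.Injective toP := by
  rintro ⟨⟨u, v⟩, z⟩ ⟨⟨u', v'⟩, z'⟩ h
  have h0 := congrFun h 0
  have h1 := congrFun h 1
  have h2 := congrFun h 2
  simp only [toP, Matrix.cons_val_zero, Matrix.cons_val_one, Matrix.cons_val] at h0 h1 h2
  have hI := Complex.I_ne_zero
  have h1' : u - v = u' - v' := by field_simp at h1; exact h1
  have hu : u = u' := by linear_combination h0 + h1'/2
  have hv : v = v' := by linear_combination h0 - h1'/2
  simp [hu, hv, h2]

open MvPolynomial in
/-- The nonic surface `f = J₉(x,y) + z³(3-3z+z²)³ = 0` has exactly 127 singular points in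
`ℂ³`, and at each of them the Hessian of `f` has rank 2 (they are all cusps, `A₂`). -/
theorem stmt16 (J : MvPolynomial (Fin 3) ℂ)
    (hJ : ∀ x y z : ℝ,
      MvPolynomial.eval ![(x : ℂ), (y : ℂ), (z : ℂ)] J =
        -1 + 2 * ((j9 ((x : ℂ) + (y : ℂ) * Complex.I)
          ((x : ℂ) - (y : ℂ) * Complex.I)).re : ℂ))
    (f : MvPolynomial (Fin 3) ℂ)
    (hf : f = J + X 2 ^ 3 * (C 3 - C 3 * X 2 + X 2 ^ 2) ^ 3) :
    {p : Fin 3 → ℂ | eval p f = 0 ∧ ∀ i, eval p (pderiv i f) = 0}.Finite ∧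
    {p : Fin 3 → ℂ | eval p f = 0 ∧ ∀ i, eval p (pderiv i f) = 0}.ncard = 127 ∧
    ∀ p : Fin 3 → ℂ, eval p f = 0 → (∀ i, eval p (pderiv i f) = 0) →
      (Matrix.of fun i j : Fin 3 => eval p (pderiv i (pderiv j f))).rank = 2 := by
  obtain ⟨ζ, hζ, hb, h9, hc⟩ := bfacts
  set U : MvPolynomial (Fin 3) ℂ := X 0 + C Complex.I * X 1 with hU
  set V : MvPolynomial (Fin 3) ℂ := X 0 - C Complex.I * X 1 with hV
  have hJp : J = Fg (C bC) U V := by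
    apply MvPolynomial.funext_set (fun _ => Set.range (fun x : ℝ => (x : ℂ)))
    · intro i
      exact Set.infinite_range_of_injective Complex.ofReal_injective
    · intro p hp
      obtain ⟨x, hx⟩ := hp 0 trivial
      obtain ⟨y, hy⟩ := hp 1 trivial
      obtain ⟨z, hz⟩ := hp 2 trivial
      have hpe : p = ![(x : ℂ), (y : ℂ), (z : ℂ)] := by
        ext i; fin_cases i <;> simp [← hx, ← hy, ← hz]
      rw [hpe, hJ, j9_conj hc, map_Fg]
      simp [hU, hV]
  have hfe : f = Fg (C bC) U V + (1 - (1 - X 2)^3)^3 := by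
    rw [hf, hJp, show (C 3 : MvPolynomial (Fin 3) ℂ) = 3 from map_ofNat C 3]; ring
  have dU0 : pderiv 0 U = 1 := by simp [hU, pderiv_X]
  have dU1 : pderiv 1 U = C Complex.I := by simp [hU, pderiv_X]
  have dU2 : pderiv 2 U = 0 := by simp [hU, pderiv_X]
  have dV0 : pderiv 0 V = 1 := by simp [hV, pderiv_X]
  have dV1 : pderiv 1 V = -C Complex.I := by simp [hV, pderiv_X]
  have dV2 : pderiv 2 V = 0 := by simp [hV, pderiv_X]
  have X02 : pderiv (0 : Fin 3) (X 2 : MvPolynomial (Fin 3) ℂ) = 0 := by simp [pderiv_X]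
  have X12 : pderiv (1 : Fin 3) (X 2 : MvPolynomial (Fin 3) ℂ) = 0 := by simp [pderiv_X]
  have X22 : pderiv (2 : Fin 3) (X 2 : MvPolynomial (Fin 3) ℂ) = 1 := by simp
  have db : ∀ i : Fin 3, pderiv i (C bC : MvPolynomial (Fin 3) ℂ) = 0 := fun i => pderiv_C
  have dI : ∀ i : Fin 3, pderiv i (C Complex.I : MvPolynomial (Fin 3) ℂ) = 0 := fun i => pderiv_C
  have d9 : ∀ i : Fin 3, pderiv i (9 : MvPolynomial (Fin 3) ℂ) = 0 := fun i => by
    simpa using (pderiv i : Derivation ℂ (MvPolynomial (Fin 3) ℂ) _).map_natCast 9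
  have f0 : pderiv 0 f = Fu (C bC) U V + Fv (C bC) U V := by
    rw [hfe, map_add, D_Fg _ _ _ _ (db 0), dU0, dV0]
    simp [Derivation.leibniz_pow, X02]
  have f1 : pderiv 1 f = C Complex.I * (Fu (C bC) U V - Fv (C bC) U V) := by
    rw [hfe, map_add, D_Fg _ _ _ _ (db 1), dU1, dV1]
    simp [Derivation.leibniz_pow, X12]; ring
  have f2 : pderiv 2 f = 9*(1 - (1 - X 2)^3)^2*(1 - X 2)^2 := by
    rw [hfe, map_add, D_Fg _ _ _ _ (db 2), dU2, dV2]
    simp only [Derivation.leibniz_pow, X22, map_sub, Derivation.map_one_eq_zero, smul_eq_mul,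
      nsmul_eq_mul]
    push_cast; ring
  have eU : ∀ p, eval p U = p 0 + Complex.I * p 1 := fun p => by simp [hU]
  have eV : ∀ p, eval p V = p 0 - Complex.I * p 1 := fun p => by simp [hV]
  have sing : ∀ p, (eval p f = 0 ∧ ∀ i, eval p (pderiv i f) = 0) ↔
      ((p 0 + Complex.I * p 1, p 0 - Complex.I * p 1) ∈ K bC 0 ∧ (1 - p 2)^3 = 1) ∨
      ((p 0 + Complex.I * p 1, p 0 - Complex.I * p 1) ∈ K bC (-1) ∧ p 2 = 1) := by
    intro p
    rw [Fin.forall_fin_succ, Fin.forall_fin_two]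
    change (_ ∧ _ ∧ eval p (pderiv 1 f) = 0 ∧ eval p (pderiv 2 f) = 0) ↔ _
    rw [f0, f1, f2, hfe]
    simp only [map_add, map_sub, map_mul, map_pow, map_Fg, map_Fu, map_Fv, eU, eV, eval_C, eval_X,
      map_one, map_ofNat, K, Set.mem_setOf_eq]
    generalize p 0 + Complex.I * p 1 = u
    generalize p 0 - Complex.I * p 1 = v
    have hI := Complex.I_ne_zero
    constructor
    · rintro ⟨g, a, c, d⟩
      have c' := (mul_eq_zero.1 c).resolve_left hI
      have a1 : Fu bC u v = 0 := by linear_combination (a + c')/2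
      have a2 : Fv bC u v = 0 := by linear_combination (a - c')/2
      rcases mul_eq_zero.1 d with d | d
      · have d' : 1 - (1 - p 2)^3 = 0 := by simpa using d
        left
        refine ⟨⟨a1, a2, ?_⟩, by linear_combination -d'⟩
        rw [d'] at g; simpa using g
      · have d' : 1 - p 2 = 0 := by simpa using d
        right
        refine ⟨⟨a1, a2, ?_⟩, by linear_combination -d'⟩
        rw [d'] at g; linear_combination g
    · rintro (⟨⟨a1, a2, g⟩, z⟩ | ⟨⟨a1, a2, g⟩, z⟩)
      · rw [a1, a2, g, z]; simp
      · rw [a1, a2, g, z]; simp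
  have hset : {p : Fin 3 → ℂ | eval p f = 0 ∧ ∀ i, eval p (pderiv i f) = 0} =
      toP '' ((K bC 0 ×ˢ {z : ℂ | (1-z)^3 = 1}) ∪ (K bC (-1) ×ˢ {1})) := by
    ext p
    rw [Set.mem_setOf_eq, sing]
    have hI := Complex.I_ne_zero
    constructor
    · intro h
      refine ⟨((p 0 + Complex.I * p 1, p 0 - Complex.I * p 1), p 2), h, ?_⟩
      ext i
      fin_cases i
      · simp [toP]
      · simp only [toP]; simp; field_simp; ring
      · simp [toP]
    · rintro ⟨⟨⟨u, v⟩, z⟩, h, rfl⟩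
      have e1 : toP ((u, v), z) 0 + Complex.I * toP ((u, v), z) 1 = u := by
        simp [toP]; field_simp; ring
      have e2 : toP ((u, v), z) 0 - Complex.I * toP ((u, v), z) 1 = v := by
        simp [toP]; field_simp; ring
      have e3 : toP ((u, v), z) 2 = z := by simp [toP]
      rw [e1, e2, e3]
      exact h
  obtain ⟨k0f, k0⟩ := K0_ncard hζ hb h9
  obtain ⟨k1f, k1⟩ := K1_ncard hζ hb h9
  obtain ⟨zf, z3⟩ := cube_roots_ncard hζ
  have F1 := k0f.prod zf
  have F2 := k1f.prod (Set.finite_singleton (1:ℂ))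
  refine ⟨?_, ?_, ?_⟩
  · rw [hset]; exact (F1.union F2).image _
  · rw [hset, Set.ncard_image_of_injective _ toP_inj, Set.ncard_union_eq _ F1 F2, Set.ncard_prod,
      Set.ncard_prod, k0, k1, z3, Set.ncard_singleton]
    rw [Set.disjoint_left]
    rintro ⟨q, z⟩ ⟨-, h⟩ ⟨-, h'⟩
    simp only [Set.mem_setOf_eq, Set.mem_singleton_iff] at h h'
    rw [h'] at h; simp at h
  · intro p hp hp'
    have hs := (sing p).1 ⟨hp, hp'⟩
    have hH : Fuu bC (p 0 + Complex.I * p 1) (p 0 - Complex.I * p 1) *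
        Fvv bC (p 0 + Complex.I * p 1) (p 0 - Complex.I * p 1) -
        Fuv bC (p 0 + Complex.I * p 1) (p 0 - Complex.I * p 1) ^ 2 ≠ 0 := by
      rcases hs with ⟨h, -⟩ | ⟨h, -⟩
      · exact K_hess hb (Or.inl rfl) h
      · exact K_hess hb (Or.inr rfl) h
    have hz : (1 - (1 - p 2)^3) * (1 - p 2) = 0 := by
      rcases hs with ⟨-, h⟩ | ⟨-, h⟩ <;> rw [h] <;> simp
    have hI2 := Complex.I_sq
    apply rank_two
    · simp only [Matrix.of_apply, f2]
      simp [Derivation.leibniz, Derivation.leibniz_pow, X02, d9]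
    · simp only [Matrix.of_apply, f2]
      simp [Derivation.leibniz, Derivation.leibniz_pow, X12, d9]
    · simp only [Matrix.of_apply, f0, map_add, D_Fu _ _ _ _ (db 2), D_Fv _ _ _ _ (db 2), dU2, dV2]
      simp
    · simp only [Matrix.of_apply, f1, map_sub, Derivation.leibniz, dI, D_Fu _ _ _ _ (db 2),
        D_Fv _ _ _ _ (db 2), dU2, dV2]
      simp
    · simp only [Matrix.of_apply, f2]
      simp only [Derivation.leibniz, Derivation.leibniz_pow, X22, d9, map_sub,
        Derivation.map_one_eq_zero, smul_eq_mul, nsmul_eq_mul, map_add, map_mul, map_pow, eval_X,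
        map_one, map_ofNat, map_natCast, map_zero]
      push_cast
      linear_combination (18*3*(1-p 2)^3 - 18*(1 - (1 - p 2)^3)) * hz
    · simp only [Matrix.of_apply, f0, f1, map_sub, map_add, Derivation.leibniz, dI,
        D_Fu _ _ _ _ (db _), D_Fv _ _ _ _ (db _), dU0, dV0, dU1, dV1, smul_eq_mul, map_mul,
        map_Fuu, map_Fuv, map_Fvv, eval_C, eU, eV, map_one, map_zero, map_neg]
      intro h0
      apply hH
      linear_combination -h0/4 + (Fuu bC (p 0 + Complex.I * p 1) (p 0 - Complex.I * p 1) * Fvv bC (p 0 + Complex.I * p 1) (p 0 - Complex.I * p 1) -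
        Fuv bC (p 0 + Complex.I * p 1) (p 0 - Complex.I * p 1) ^ 2) * hI2
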